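/- Let Ω be a probability space, let X : Ω → 𝒳 and Y : Ω → 𝒴 be measurable random variables with 𝒳 and 𝒴 finite, let φ : 𝒳 → 𝒰 and ψ : 𝒳 → 𝒱 be functions into finite types, and let a > 0 be a real number. Then H[Y | φ ∘ X] − a · H[Y | ψ ∘ X] = H[Y | X] − a · H[Y] holds if and only if both H[Y | φ ∘ X] = H[Y | X] and H[Y | ψ ∘ X] = H[Y]. -/

import Mathlib

open scoped BigOperators
open Real

/-- Probability that a finite-valued random variable takes a given value. -/
noncomputable def probOf {Ω α : Type*} [MeasurableSpace Ω]
    (μ : MeasureTheory.Measure Ω) (X : Ω → α) (x : α) : ℝ :=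
  (μ (X ⁻¹' {x})).toReal

/-- Joint probability `P(Y = y, Z = z)` for finite-valued random variables. -/
noncomputable def jointProb {Ω α β : Type*} [MeasurableSpace Ω]
    (μ : MeasureTheory.Measure Ω) (Y : Ω → α) (Z : Ω → β) (y : α) (z : β) : ℝ :=
  (μ (Y ⁻¹' {y} ∩ Z ⁻¹' {z})).toReal

/-- Shannon entropy `H[Y] = -∑ y, P(Y = y) log P(Y = y)` of a finite-valued random variable. -/
noncomputable def shannonEntropy {Ω α : Type*} [MeasurableSpace Ω] [Fintype α]
    (μ : MeasureTheory.Measure Ω) (Y : Ω → α) : ℝ :=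
  -∑ y, probOf μ Y y * Real.log (probOf μ Y y)

/-- Shannon conditional entropy
`H[Y | Z] = ∑ z, P(Z = z) * (-∑ y, P(Y = y | Z = z) log P(Y = y | Z = z))`
for finite-valued random variables, with `P(Y = y | Z = z) = P(Y = y, Z = z) / P(Z = z)`. -/
noncomputable def shannonCondEntropy {Ω α β : Type*} [MeasurableSpace Ω] [Fintype α] [Fintype β]
    (μ : MeasureTheory.Measure Ω) (Y : Ω → α) (Z : Ω → β) : ℝ :=
  ∑ z, probOf μ Z z *
    (-∑ y, (jointProb μ Y Z y z / probOf μ Z z) *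
      Real.log (jointProb μ Y Z y z / probOf μ Z z))

/-- The log sum inequality, in terms of the perspective of `Real.negMulLog`. -/
lemma sum_mul_negMulLog_div_le {ι : Type*} (s : Finset ι) (q r : ι → ℝ)
    (hq : ∀ i ∈ s, 0 ≤ q i) (hr : ∀ i ∈ s, 0 ≤ r i) (hqr : ∀ i ∈ s, r i = 0 → q i = 0) :
    ∑ i ∈ s, r i * negMulLog (q i / r i) ≤
      (∑ i ∈ s, r i) * negMulLog ((∑ i ∈ s, q i) / ∑ i ∈ s, r i) := by
  rcases (Finset.sum_nonneg hr).eq_or_lt with h0 | hpos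
  · have hz := (Finset.sum_eq_zero_iff_of_nonneg hr).1 h0.symm
    rw [← h0, zero_mul, Finset.sum_eq_zero fun i hi => by rw [hz i hi, zero_mul]]
  · set R := ∑ i ∈ s, r i
    have jensen := concaveOn_negMulLog.le_map_sum (t := s) (w := fun i => r i / R)
      (p := fun i => q i / r i) (fun i hi => div_nonneg (hr i hi) hpos.le)
      (by rw [← Finset.sum_div, div_self hpos.ne'])
      (fun i hi => div_nonneg (hq i hi) (hr i hi))
    have hmean : ∑ i ∈ s, (r i / R) • (q i / r i) = (∑ i ∈ s, q i) / R := by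
      rw [Finset.sum_div]
      refine Finset.sum_congr rfl fun i hi => ?_
      by_cases h : r i = 0
      · simp [h, hqr i hi h]
      · rw [smul_eq_mul]
        field_simp
    rw [hmean] at jensen
    calc ∑ i ∈ s, r i * negMulLog (q i / r i)
        = R * ∑ i ∈ s, (r i / R) • negMulLog (q i / r i) := by
          rw [Finset.mul_sum]
          refine Finset.sum_congr rfl fun i _ => ?_
          rw [smul_eq_mul]
          field_simp
      _ ≤ _ := mul_le_mul_of_nonneg_left jensen hpos.le

section Entropy

open MeasureTheory

variable {Ω α β γ : Type*} [MeasurableSpace Ω] (μ : Measure Ω)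

lemma shannonCondEntropy_eq_sum_negMulLog [Fintype α] [Fintype β] (Y : Ω → α) (Z : Ω → β) :
    shannonCondEntropy μ Y Z =
      ∑ y, ∑ z, probOf μ Z z * negMulLog (jointProb μ Y Z y z / probOf μ Z z) := by
  rw [Finset.sum_comm]
  simp only [shannonCondEntropy, negMulLog, ← Finset.sum_neg_distrib, Finset.mul_sum, neg_mul]

lemma jointProb_eq_zero_of_probOf_eq_zero [IsFiniteMeasure μ] (Y : Ω → α) (Z : Ω → β)
    (y : α) (z : β) (h : probOf μ Z z = 0) : jointProb μ Y Z y z = 0 :=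
  le_antisymm (h ▸ measureReal_mono (μ := μ) Set.inter_subset_right) ENNReal.toReal_nonneg

open scoped Classical in
lemma probOf_comp [Fintype β] [IsFiniteMeasure μ] {Z : Ω → β} (hZ : ∀ z, MeasurableSet (Z ⁻¹' {z}))
    (f : β → γ) (c : γ) : probOf μ (f ∘ Z) c = ∑ z with f z = c, probOf μ Z z := by
  simp only [probOf]
  rw [← ENNReal.toReal_sum fun _ _ => measure_ne_top _ _,
    sum_measure_preimage_singleton _ fun z _ => hZ z]
  congr 2
  ext ω
  simp

lemma jointProb_eq_probOf_restrict (Y : Ω → α) {Z : Ω → β} (y : α) {z : β}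
    (hZ : MeasurableSet (Z ⁻¹' {z})) :
    jointProb μ Y Z y z = probOf (μ.restrict (Y ⁻¹' {y})) Z z := by
  rw [jointProb, probOf, Measure.restrict_apply hZ, Set.inter_comm]

lemma measurableSet_comp_preimage_singleton [Finite β] {Z : Ω → β}
    (hZ : ∀ z, MeasurableSet (Z ⁻¹' {z})) (f : β → γ) (c : γ) :
    MeasurableSet ((f ∘ Z) ⁻¹' {c}) := by
  rw [Set.preimage_comp, ← Set.biUnion_preimage_singleton]
  exact MeasurableSet.biUnion (Set.to_countable _) fun z _ => hZ z

open scoped Classical in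
lemma jointProb_comp [Fintype β] [IsFiniteMeasure μ] (Y : Ω → α) {Z : Ω → β}
    (hZ : ∀ z, MeasurableSet (Z ⁻¹' {z})) (f : β → γ) (y : α) (c : γ) :
    jointProb μ Y (f ∘ Z) y c = ∑ z with f z = c, jointProb μ Y Z y z := by
  simp only [jointProb_eq_probOf_restrict μ Y y (hZ _),
    jointProb_eq_probOf_restrict μ Y y (measurableSet_comp_preimage_singleton hZ f c)]
  exact probOf_comp _ hZ f c

/-- Conditioning on a function of `Z` leaves at least as much entropy as conditioning on `Z`. -/
lemma shannonCondEntropy_le_comp [Fintype α] [Fintype β] [Fintype γ] [IsFiniteMeasure μ]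
    (Y : Ω → α) {Z : Ω → β}
    (hZ : ∀ z, MeasurableSet (Z ⁻¹' {z})) (f : β → γ) :
    shannonCondEntropy μ Y Z ≤ shannonCondEntropy μ Y (f ∘ Z) := by
  classical
  simp only [shannonCondEntropy_eq_sum_negMulLog]
  refine Finset.sum_le_sum fun y _ => ?_
  rw [← Finset.sum_fiberwise Finset.univ f]
  refine Finset.sum_le_sum fun c _ => ?_
  rw [probOf_comp μ hZ, jointProb_comp μ Y hZ]
  exact sum_mul_negMulLog_div_le _ _ _ (fun _ _ => ENNReal.toReal_nonneg)
    (fun _ _ => ENNReal.toReal_nonneg)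
    fun z _ => jointProb_eq_zero_of_probOf_eq_zero μ Y Z y z

lemma shannonCondEntropy_unit [Fintype α] [IsProbabilityMeasure μ] (Y : Ω → α) (Z : Ω → Unit) :
    shannonCondEntropy μ Y Z = shannonEntropy μ Y := by
  have hZ : Z ⁻¹' {()} = Set.univ := Set.eq_univ_of_forall fun _ => rfl
  simp [shannonCondEntropy, shannonEntropy, probOf, jointProb, hZ]

/-- Conditioning does not increase entropy. -/
lemma shannonCondEntropy_le_shannonEntropy [Fintype α] [Fintype β] [IsProbabilityMeasure μ]
    (Y : Ω → α) {Z : Ω → β}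
    (hZ : ∀ z, MeasurableSet (Z ⁻¹' {z})) :
    shannonCondEntropy μ Y Z ≤ shannonEntropy μ Y :=
  (shannonCondEntropy_le_comp μ Y hZ fun _ => ()).trans_eq (shannonCondEntropy_unit μ Y _)

end Entropy

/-- Equality case of the selector-loss lower bound: for `a > 0`,
`H[Y | φ ∘ X] - a * H[Y | ψ ∘ X] = H[Y | X] - a * H[Y]` holds iff both
`H[Y | φ ∘ X] = H[Y | X]` (sufficiency) and `H[Y | ψ ∘ X] = H[Y]` (completeness). -/
theorem selector_loss_eq_iff
    {Ω 𝒳 𝒴 𝒰 𝒱 : Type*} [MeasurableSpace Ω]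
    [MeasurableSpace 𝒳] [MeasurableSingletonClass 𝒳] [Fintype 𝒳]
    [MeasurableSpace 𝒴] [MeasurableSingletonClass 𝒴] [Fintype 𝒴]
    [Fintype 𝒰] [Fintype 𝒱]
    (μ : MeasureTheory.Measure Ω) [MeasureTheory.IsProbabilityMeasure μ]
    (X : Ω → 𝒳) (Y : Ω → 𝒴) (hX : Measurable X) (hY : Measurable Y)
    (φ : 𝒳 → 𝒰) (ψ : 𝒳 → 𝒱) (a : ℝ) (ha : 0 < a) :
    shannonCondEntropy μ Y (φ ∘ X) - a * shannonCondEntropy μ Y (ψ ∘ X)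
        = shannonCondEntropy μ Y X - a * shannonEntropy μ Y ↔
      (shannonCondEntropy μ Y (φ ∘ X) = shannonCondEntropy μ Y X ∧
        shannonCondEntropy μ Y (ψ ∘ X) = shannonEntropy μ Y) := by
  have hXm : ∀ x, MeasurableSet (X ⁻¹' {x}) := fun x => hX (measurableSet_singleton x)
  have hφ := shannonCondEntropy_le_comp μ Y hXm φ
  have hψ := shannonCondEntropy_le_shannonEntropy μ Y
    (measurableSet_comp_preimage_singleton hXm ψ)
  constructor
  · intro h
    constructor <;> nlinarith
  · rintro ⟨h₁, h₂⟩
    rw [h₁, h₂]
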